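/- arXiv:2407.02316 — 3 statements merged into one kernel-verified Lean document; each statement's English description precedes it below -/
import Mathlib

section
/- Let G be a finite group and S ⊆ G with 1 ∉ S. The Cayley digraph Γ = Cay(G,S) is isomorphic to a nontrivial wreath product of two vertex-transitive digraphs of smaller order (each with at least two vertices) if and only if there exists a subgroup K with 1 < K < G such that S∖K is a union of double cosets of K in G. Moreover, if such K exists and ℬ is the set of left cosets of K in G, then Cay(G,S) ≅ Γ/ℬ ≀ Γ[K] ≅ Cos(G,K,S∖K) ≀ Cay(K, S∩K). -/
open scoped Pointwise

namespace DCG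

/-- An isomorphism of digraphs: a bijection of vertex sets mapping arcs to arcs and
non-arcs to non-arcs. -/
structure Iso {V W : Type*} (Γ₁ : Digraph V) (Γ₂ : Digraph W) extends V ≃ W where
  adj_iff : ∀ u v : V, Γ₂.Adj (toEquiv u) (toEquiv v) ↔ Γ₁.Adj u v

/-- The wreath product of two digraphs. -/
def wr {V₁ V₂ : Type*} (Γ₁ : Digraph V₁) (Γ₂ : Digraph V₂) : Digraph (V₁ × V₂) where
  Adj p q := Γ₁.Adj p.1 q.1 ∨ (p.1 = q.1 ∧ Γ₂.Adj p.2 q.2)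

/-- The automorphism group of a digraph, as a subgroup of the symmetric group on the
vertices. -/
def Aut {V : Type*} (Γ : Digraph V) : Subgroup (Equiv.Perm V) where
  carrier := {e | ∀ u v : V, Γ.Adj (e u) (e v) ↔ Γ.Adj u v}
  one_mem' := by intro u v; rfl
  mul_mem' := by
    intro a b ha hb u v
    simpa [Equiv.Perm.mul_apply] using ((ha (b u) (b v)).trans (hb u v))
  inv_mem' := by
    intro a ha u v
    simpa using (ha (a⁻¹ u) (a⁻¹ v)).symm

/-- A subgroup of the symmetric group is transitive. -/
def IsTransitiveSub {V : Type*} (A : Subgroup (Equiv.Perm V)) : Prop :=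
  ∀ u v : V, ∃ g ∈ A, (g : Equiv.Perm V) u = v

/-- A digraph is vertex-transitive when its automorphism group is transitive. -/
def IsVertexTransitive {V : Type*} (Γ : Digraph V) : Prop :=
  IsTransitiveSub (Aut Γ)

/-- `ℬ` is a block system of the permutation group `A`: an `A`-invariant partition of the
point set. -/
def IsBlockSystemOf {V : Type*} (A : Subgroup (Equiv.Perm V)) (ℬ : Set (Set V)) : Prop :=
  Setoid.IsPartition ℬ ∧ ∀ g ∈ A, ∀ B ∈ ℬ, (g : Equiv.Perm V) '' B ∈ ℬ

/-- The block quotient digraph of `Γ` with respect to a set `ℬ` of sets of vertices. -/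
def quotDgr {V : Type*} (Γ : Digraph V) (ℬ : Set (Set V)) : Digraph ℬ where
  Adj B B' := B ≠ B' ∧ ∃ x ∈ (B : Set V), ∃ y ∈ (B' : Set V), Γ.Adj x y

/-- The subdigraph of `Γ` induced on a set `B` of vertices. -/
def induce {V : Type*} (Γ : Digraph V) (B : Set V) : Digraph B where
  Adj x y := Γ.Adj (x : V) (y : V)

/-- The double coset digraph `Cos(G,H,S)`. -/
def cos (G : Type*) [Group G] (H : Subgroup G) (S : Set G) : Digraph (G ⧸ H) where
  Adj a b := ∃ g s : G, s ∈ S ∧ a = QuotientGroup.mk g ∧ b = QuotientGroup.mk (g * s)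

/-- The Cayley digraph `Cay(G,S)`. -/
def cay (G : Type*) [Group G] (S : Set G) : Digraph G where
  Adj a b := ∃ s ∈ S, b = a * s

/-- The digraph on `n` vertices with no arcs. -/
def empt (n : ℕ) : Digraph (Fin n) where
  Adj _ _ := False

/-- The wreath product of two permutation groups, in its imprimitive action. -/
def permWr {X Y : Type*} (A : Subgroup (Equiv.Perm X)) (B : Subgroup (Equiv.Perm Y)) :
    Subgroup (Equiv.Perm (X × Y)) where
  carrier := {e | ∃ g ∈ A, ∃ h : X → Equiv.Perm Y, (∀ x, h x ∈ B) ∧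
    ∀ p : X × Y, e p = (g p.1, h p.1 p.2)}
  one_mem' := ⟨1, A.one_mem, fun _ => 1, fun _ => B.one_mem, fun _ => rfl⟩
  mul_mem' := by
    rintro a b ⟨g₁, hg₁, h₁, hh₁, he₁⟩ ⟨g₂, hg₂, h₂, hh₂, he₂⟩
    refine ⟨g₁ * g₂, A.mul_mem hg₁ hg₂, fun x => h₁ (g₂ x) * h₂ x,
      fun x => B.mul_mem (hh₁ _) (hh₂ _), fun p => ?_⟩
    simp [Equiv.Perm.mul_apply, he₁, he₂]
  inv_mem' := by
    rintro a ⟨g, hg, h, hh, he⟩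
    refine ⟨g⁻¹, A.inv_mem hg, fun x => (h (g⁻¹ x))⁻¹,
      fun x => B.inv_mem (hh _), fun p => ?_⟩
    have key : a (g⁻¹ p.1, (h (g⁻¹ p.1))⁻¹ p.2) = p := by
      rw [he]
      simp [Equiv.Perm.mul_apply]
    calc a⁻¹ p = a⁻¹ (a (g⁻¹ p.1, (h (g⁻¹ p.1))⁻¹ p.2)) := by rw [key]
    _ = (g⁻¹ p.1, (h (g⁻¹ p.1))⁻¹ p.2) := by simp

/-- The induced action of a permutation group `A` on a system `ℬ` of sets of points,
as a subgroup of the symmetric group on `ℬ`. -/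
def inducedOn {X : Type*} (A : Subgroup (Equiv.Perm X)) (ℬ : Set (Set X)) :
    Subgroup (Equiv.Perm ℬ) where
  carrier := {σ | ∃ g ∈ A, ∀ B : ℬ, ((σ B : Set X)) = (g : Equiv.Perm X) '' (B : Set X)}
  one_mem' := ⟨1, A.one_mem, by simp⟩
  mul_mem' := by
    rintro a b ⟨g₁, hg₁, h₁⟩ ⟨g₂, hg₂, h₂⟩
    refine ⟨g₁ * g₂, A.mul_mem hg₁ hg₂, fun B => ?_⟩
    have : ((a * b) B : Set X) = (a (b B) : Set X) := rfl
    rw [this, h₁, h₂]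
    ext x
    simp [Equiv.Perm.mul_apply, Set.image_image]
  inv_mem' := by
    rintro a ⟨g, hg, h⟩
    refine ⟨g⁻¹, A.inv_mem hg, fun B => ?_⟩
    have hb : ((a (a⁻¹ B)) : Set X) = (g : Equiv.Perm X) '' ((a⁻¹ B : ℬ) : Set X) := h _
    have hab : a (a⁻¹ B) = B := by simp
    rw [hab] at hb
    rw [hb]
    ext x
    simp

/-- A digraph is complete if every ordered pair of distinct vertices is an arc. -/
def IsComplete {V : Type*} (Γ : Digraph V) : Prop := ∀ u v : V, u ≠ v → Γ.Adj u v

/-- A digraph has no arcs. -/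
def HasNoArcs {V : Type*} (Γ : Digraph V) : Prop := ∀ u v : V, ¬ Γ.Adj u v

/-- A digraph is reducible if two distinct vertices have the same out-neighbours and the
same in-neighbours. -/
def Reducible {V : Type*} (Γ : Digraph V) : Prop :=
  ∃ u v : V, u ≠ v ∧ (∀ w, Γ.Adj u w ↔ Γ.Adj v w) ∧ (∀ w, Γ.Adj w u ↔ Γ.Adj w v)

/-- A regular subgroup of a symmetric group: transitive, and only the identity fixes a
point. -/
def IsRegularSub {X : Type*} [Nonempty X] (L : Subgroup (Equiv.Perm X)) : Prop :=
  IsTransitiveSub L ∧ ∀ g ∈ L, (∃ x : X, (g : Equiv.Perm X) x = x) → g = 1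

/-- A block system for a multiplicative action: an invariant partition. -/
def IsBlockSystemMul (G : Type*) [Group G] {X : Type*} [MulAction G X]
    (ℬ : Set (Set X)) : Prop :=
  Setoid.IsPartition ℬ ∧ ∀ (g : G), ∀ B ∈ ℬ, g • B ∈ ℬ

/-- `Γ` is isomorphic to a nontrivial wreath product of two vertex-transitive digraphs,
each with at least two vertices. -/
def IsNontrivialWreathProduct {V : Type*} (Γ : Digraph V) : Prop :=
  ∃ (V₁ V₂ : Type) (Γ₁ : Digraph V₁) (Γ₂ : Digraph V₂),
    IsVertexTransitive Γ₁ ∧ IsVertexTransitive Γ₂ ∧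
    2 ≤ Nat.card V₁ ∧ 2 ≤ Nat.card V₂ ∧ Nonempty (Iso Γ (wr Γ₁ Γ₂))

/-- The block quotient of a digraph on `G` by the partition of `G` into left cosets
of `H`, realized on the vertex set `G ⧸ H`. -/
def cosetQuot (G : Type*) [Group G] (H : Subgroup G) (Γ : Digraph G) : Digraph (G ⧸ H) where
  Adj a b := a ≠ b ∧ ∃ x y : G, (QuotientGroup.mk x : G ⧸ H) = a ∧
    (QuotientGroup.mk y : G ⧸ H) = b ∧ Γ.Adj x y



section

variable {G : Type*} [Group G]

theorem cay_adj {S : Set G} {a b : G} : (cay G S).Adj a b ↔ a⁻¹ * b ∈ S := by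
  constructor
  · rintro ⟨s, hs, rfl⟩
    simpa using hs
  · intro h
    exact ⟨_, h, by simp⟩

theorem cay_adj_mul_left {S : Set G} (g a b : G) :
    (cay G S).Adj (g * a) (g * b) ↔ (cay G S).Adj a b := by
  simp [cay_adj, mul_assoc]

/-! ### Isomorphisms -/

/-- The inverse of an isomorphism of digraphs. -/
def Iso.symm {V W : Type*} {Γ : Digraph V} {Δ : Digraph W} (e : Iso Γ Δ) : Iso Δ Γ where
  toEquiv := e.toEquiv.symm
  adj_iff u v := by rw [← e.adj_iff]; simp

/-- The composition of two isomorphisms of digraphs. -/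
def Iso.trans {V W X : Type*} {Γ : Digraph V} {Δ : Digraph W} {Λ : Digraph X}
    (e : Iso Γ Δ) (f : Iso Δ Λ) : Iso Γ Λ where
  toEquiv := e.toEquiv.trans f.toEquiv
  adj_iff u v := (f.adj_iff _ _).trans (e.adj_iff u v)

/-- The wreath product of two isomorphisms of digraphs. -/
def Iso.wrCongr {V₁ V₂ W₁ W₂ : Type*} {Γ₁ : Digraph V₁} {Γ₂ : Digraph V₂} {Δ₁ : Digraph W₁}
    {Δ₂ : Digraph W₂} (e : Iso Γ₁ Δ₁) (f : Iso Γ₂ Δ₂) : Iso (wr Γ₁ Γ₂) (wr Δ₁ Δ₂) where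
  toEquiv := e.toEquiv.prodCongr f.toEquiv
  adj_iff u v := by simp [wr, e.adj_iff, f.adj_iff]

theorem IsVertexTransitive.of_iso {V W : Type*} {Γ : Digraph V} {Δ : Digraph W}
    (h : IsVertexTransitive Γ) (e : Iso Γ Δ) : IsVertexTransitive Δ := by
  intro u v
  obtain ⟨σ, hσ, huv⟩ := h (e.toEquiv.symm u) (e.toEquiv.symm v)
  refine ⟨(e.toEquiv.symm.trans σ).trans e.toEquiv, fun x y => ?_, by simp [huv]⟩
  refine (e.adj_iff _ _).trans ((hσ _ _).trans ?_)
  exact e.symm.adj_iff x y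

/-- The digraph on the vertex set `W` corresponding to `Γ` under a bijection. -/
def transport {V W : Type*} (Γ : Digraph V) (e : V ≃ W) : Digraph W where
  Adj u v := Γ.Adj (e.symm u) (e.symm v)

/-- A digraph is isomorphic to its transport along a bijection. -/
def transportIso {V W : Type*} (Γ : Digraph V) (e : V ≃ W) : Iso Γ (transport Γ e) where
  toEquiv := e
  adj_iff u v := by simp [transport]

theorem isVertexTransitive_cay (S : Set G) : IsVertexTransitive (cay G S) := by
  intro u v
  exact ⟨Equiv.mulLeft (v * u⁻¹), fun a b => cay_adj_mul_left _ a b, by simp⟩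

theorem cos_adj_smul {K : Subgroup G} {T : Set G} (g : G) {a b : G ⧸ K}
    (h : (cos G K T).Adj a b) : (cos G K T).Adj (g • a) (g • b) := by
  obtain ⟨x, s, hs, rfl, rfl⟩ := h
  exact ⟨g * x, s, hs, rfl, by rw [mul_assoc]; rfl⟩

theorem isVertexTransitive_cos (K : Subgroup G) (T : Set G) :
    IsVertexTransitive (cos G K T) := by
  intro u v
  obtain ⟨g, rfl⟩ := MulAction.exists_smul_eq G u v
  refine ⟨MulAction.toPerm g, fun a b => ⟨fun h => ?_, cos_adj_smul g⟩, rfl⟩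
  simpa using cos_adj_smul g⁻¹ h

/-! ### The wreath decomposition given by a subgroup -/

theorem mem_of_mul_mul_eq {K : Subgroup G} {T : Set G}
    (h : (K : Set G) * T * (K : Set G) = T) {k l t : G} (hk : k ∈ K) (ht : t ∈ T) (hl : l ∈ K) :
    k * t * l ∈ T := by
  rw [← h]
  exact Set.mul_mem_mul (Set.mul_mem_mul hk ht) hl

theorem cos_adj_mk {K : Subgroup G} {T : Set G} (h : (K : Set G) * T * (K : Set G) = T)
    {a b : G} : (cos G K T).Adj (a : G ⧸ K) (b : G ⧸ K) ↔ a⁻¹ * b ∈ T := by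
  constructor
  · rintro ⟨g, s, hs, ha, hb⟩
    have hk := QuotientGroup.eq.1 ha
    have hl := QuotientGroup.eq.1 hb.symm
    convert mem_of_mul_mul_eq h hk hs hl using 1
    group
  · intro hab
    exact ⟨a, _, hab, rfl, by simp⟩

/-- Each element of the group is the chosen representative of its coset times an element of
the subgroup. -/
noncomputable def equivQuotientProd (K : Subgroup G) : G ≃ (G ⧸ K) × K where
  toFun g := (g, ⟨(g : G ⧸ K).out⁻¹ * g, QuotientGroup.eq.1 (Quotient.out_eq' _)⟩)
  invFun p := p.1.out * p.2
  left_inv g := by simp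
  right_inv := by
    rintro ⟨q, k⟩
    have : ((q.out * k : G) : G ⧸ K) = q := by
      rw [QuotientGroup.mk_mul_of_mem _ k.2]
      exact Quotient.out_eq' q
    ext <;> simp [this]

/-- The isomorphism of `Cay(G,S)` with `Cos(G,K,S∖K) ≀ Cay(K,S∩K)`. -/
noncomputable def cayIsoWr (S : Set G) (K : Subgroup G)
    (h : (K : Set G) * (S \ (K : Set G)) * (K : Set G) = S \ (K : Set G)) :
    Iso (cay G S) (wr (cos G K (S \ (K : Set G))) (cay K {k : K | (k : G) ∈ S})) where
  toEquiv := equivQuotientProd K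
  adj_iff u v := by
    simp only [wr, equivQuotientProd, Equiv.coe_fn_mk, cos_adj_mk h, cay_adj, Set.mem_ofPred_eq]
    by_cases huv : u⁻¹ * v ∈ K
    · have hq : (u : G ⧸ K) = v := QuotientGroup.eq.2 huv
      simp [hq, huv, mul_assoc]
    · have hq : (u : G ⧸ K) ≠ v := fun e => huv (QuotientGroup.eq.1 e)
      simp [hq, huv]

/-- The left cosets of a subgroup as a set of sets. -/
noncomputable def quotientEquivCosets (K : Subgroup G) :
    G ⧸ K ≃ ({B | ∃ g : G, B = g • (K : Set G)} : Set (Set G)) :=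
  Equiv.ofBijective (fun q => ⟨q.out • (K : Set G), q.out, rfl⟩) <| by
    constructor
    · intro p q hpq
      have := (leftCoset_eq_iff K).1 (Subtype.ext_iff.1 hpq)
      rw [← QuotientGroup.eq] at this
      simpa using this
    · rintro ⟨_, g, rfl⟩
      refine ⟨g, Subtype.ext ((leftCoset_eq_iff K).2 ?_)⟩
      rw [← QuotientGroup.eq]
      simp

theorem mem_quotientEquivCosets {K : Subgroup G} {q : G ⧸ K} {x : G} :
    x ∈ (quotientEquivCosets K q : Set G) ↔ (x : G ⧸ K) = q := by
  change x ∈ q.out • (K : Set G) ↔ _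
  rw [mem_leftCoset_iff, SetLike.mem_coe, ← QuotientGroup.eq]
  simp [eq_comm]

/-- The isomorphism of `Cos(G,K,S∖K)` with the block quotient of `Cay(G,S)`. -/
noncomputable def cosIsoQuot (S : Set G) (K : Subgroup G)
    (h : (K : Set G) * (S \ (K : Set G)) * (K : Set G) = S \ (K : Set G)) :
    Iso (cos G K (S \ (K : Set G)))
      (quotDgr (cay G S) {B | ∃ g : G, B = g • (K : Set G)}) where
  toEquiv := quotientEquivCosets K
  adj_iff u v := by
    simp only [quotDgr, ne_eq, EmbeddingLike.apply_eq_iff_eq, mem_quotientEquivCosets, cay_adj]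
    constructor
    · rintro ⟨hne, x, rfl, y, rfl, hxy⟩
      exact (cos_adj_mk h).2 ⟨hxy, fun hk => hne (QuotientGroup.eq.2 hk)⟩
    · induction u using QuotientGroup.induction_on with | H x
      induction v using QuotientGroup.induction_on with | H y
      intro hxy
      rw [cos_adj_mk h] at hxy
      exact ⟨fun e => hxy.2 (QuotientGroup.eq.1 e), x, rfl, y, rfl, hxy.1⟩

/-- The subdigraph of `Cay(G,S)` induced on `K` is `Cay(K,S∩K)`. -/
def cayIsoInduce (S : Set G) (K : Subgroup G) :
    Iso (cay K {k : K | (k : G) ∈ S}) (induce (cay G S) (K : Set G)) where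
  toEquiv := Equiv.refl K
  adj_iff u v := by
    change (cay G S).Adj (u : G) (v : G) ↔ _
    simp [cay_adj]

theorem isNontrivialWreathProduct_of_subgroup [Finite G] (S : Set G) (K : Subgroup G)
    (hbot : ⊥ < K) (htop : K ≠ ⊤)
    (h : (K : Set G) * (S \ (K : Set G)) * (K : Set G) = S \ (K : Set G)) :
    IsNontrivialWreathProduct (cay G S) := by
  have e₁ := transportIso (cos G K (S \ (K : Set G))) (Finite.equivFin (G ⧸ K))
  have e₂ := transportIso (cay K {k : K | (k : G) ∈ S}) (Finite.equivFin K)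
  refine ⟨_, _, _, _, (isVertexTransitive_cos K _).of_iso e₁, (isVertexTransitive_cay _).of_iso e₂,
    ?_, ?_, ⟨(cayIsoWr S K h).trans (e₁.wrCongr e₂)⟩⟩
  · rw [Nat.card_fin]
    have h0 : 0 < Nat.card (G ⧸ K) := Nat.card_pos
    have h1 : Nat.card (G ⧸ K) ≠ 1 := fun h1 => htop (Subgroup.index_eq_one.1 h1)
    lia
  · rw [Nat.card_fin]
    exact (Subgroup.one_lt_card_iff_ne_bot K).2 hbot.ne'

/-! ### Modules of digraphs -/

/-- A module of a digraph is a set of vertices that no outside vertex distinguishes. -/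
def IsModule {V : Type*} (Γ : Digraph V) (M : Set V) : Prop :=
  ∀ x ∈ M, ∀ y ∈ M, ∀ v ∉ M, (Γ.Adj v x → Γ.Adj v y) ∧ (Γ.Adj x v → Γ.Adj y v)

theorem IsModule.inter {V : Type*} {Γ : Digraph V} {M N : Set V} (hM : IsModule Γ M)
    (hN : IsModule Γ N) : IsModule Γ (M ∩ N) := by
  intro x hx y hy v hv
  by_cases hvM : v ∈ M
  · exact hN x hx.2 y hy.2 v fun hvN => hv ⟨hvM, hvN⟩
  · exact hM x hx.1 y hy.1 v hvM

theorem IsModule.diff {V : Type*} {Γ : Digraph V} {M N : Set V} (hM : IsModule Γ M)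
    (hN : IsModule Γ N) (hne : (N \ M).Nonempty) : IsModule Γ (M \ N) := by
  obtain ⟨z, hzN, hzM⟩ := hne
  intro x hx y hy v hv
  by_cases hvM : v ∈ M
  · have hvN : v ∈ N := by_contra fun hvN => hv ⟨hvM, hvN⟩
    have hvx := hN v hvN z hzN x hx.2
    have hzxy := hM x hx.1 y hy.1 z hzM
    have hzy := hN z hzN v hvN y hy.2
    exact ⟨fun h => hzy.2 (hzxy.1 (hvx.2 h)), fun h => hzy.1 (hzxy.2 (hvx.1 h))⟩
  · exact hM x hx.1 y hy.1 v hvM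

theorem IsModule.smul {S : Set G} {M : Set G} (hM : IsModule (cay G S) M) (g : G) :
    IsModule (cay G S) (g • M) := by
  intro x hx y hy v hv
  rw [Set.mem_smul_set_iff_inv_smul_mem] at hx hy hv
  simpa only [smul_eq_mul, cay_adj_mul_left] using hM _ hx _ hy _ hv

theorem IsModule.mul_mul_eq {S : Set G} {K : Subgroup G} (hK : IsModule (cay G S) (K : Set G)) :
    (K : Set G) * (S \ (K : Set G)) * (K : Set G) = S \ (K : Set G) := by
  have hleft : ∀ k ∈ K, ∀ t ∈ S \ (K : Set G), k * t ∈ S \ (K : Set G) := by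
    rintro k hk t ⟨ht, htK⟩
    refine ⟨?_, fun h => htK ((K.mul_mem_cancel_left hk).1 h)⟩
    simpa [cay_adj] using
      (hK 1 K.one_mem k⁻¹ (K.inv_mem hk) t htK).2 (cay_adj.2 (by simpa using ht))
  have hright : ∀ k ∈ K, ∀ t ∈ S \ (K : Set G), t * k ∈ S \ (K : Set G) := by
    rintro k hk t ⟨ht, htK⟩
    refine ⟨?_, fun h => htK ((K.mul_mem_cancel_right hk).1 h)⟩
    simpa [cay_adj] using
      (hK 1 K.one_mem k hk t⁻¹ (fun h => htK (K.inv_mem_iff.1 h))).1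
        (cay_adj.2 (by simpa using ht))
  refine subset_antisymm ?_ fun t ht => ?_
  · rintro _ ⟨_, ⟨k, hk, t, ht, rfl⟩, l, hl, rfl⟩
    exact hright l hl _ (hleft k hk t ht)
  · exact ⟨t, ⟨1, K.one_mem, t, ht, by simp⟩, 1, K.one_mem, by simp⟩

/-- A set containing `1` whose translates are equal to it or disjoint from it is a subgroup. -/
theorem exists_subgroup_coe_eq {M : Set G} (h1 : (1 : G) ∈ M)
    (hM : ∀ g : G, (M ∩ g • M).Nonempty → g • M = M) : ∃ K : Subgroup G, (K : Set G) = M := by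
  refine ⟨MulAction.stabilizer G M, Set.ext fun g => ⟨fun hg => ?_, fun hg => ?_⟩⟩
  · have hg : g • M = M := hg
    rw [← hg]
    simpa using Set.smul_mem_smul_set (a := g) h1
  · exact hM g ⟨g, hg, by simpa using Set.smul_mem_smul_set (a := g) h1⟩

theorem isModule_zpowers {S : Set G} {a : G} (ha : IsModule (cay G S) {1, a}) :
    IsModule (cay G S) (Subgroup.zpowers a : Set G) := by
  have hstep : ∀ v ∉ Subgroup.zpowers a, ∀ i : ℤ,
      ((cay G S).Adj v (a ^ i) ↔ (cay G S).Adj v 1) ∧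
      ((cay G S).Adj (a ^ i) v ↔ (cay G S).Adj 1 v) := by
    intro v hv
    have hsucc : ∀ i : ℤ,
        ((cay G S).Adj v (a ^ (i + 1)) ↔ (cay G S).Adj v (a ^ i)) ∧
        ((cay G S).Adj (a ^ (i + 1)) v ↔ (cay G S).Adj (a ^ i) v) := by
      intro i
      have hm := ha.smul (a ^ i)
      have hsm : a ^ i • ({1, a} : Set G) = {a ^ i, a ^ (i + 1)} := by
        simp [Set.smul_set_insert, zpow_add_one]
      rw [hsm] at hm
      have hvm : v ∉ ({a ^ i, a ^ (i + 1)} : Set G) := by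
        rintro (rfl | rfl) <;> exact hv (Subgroup.zpow_mem_zpowers _ _)
      have h₁ := hm (a ^ i) (by simp) (a ^ (i + 1)) (by simp) v hvm
      have h₂ := hm (a ^ (i + 1)) (by simp) (a ^ i) (by simp) v hvm
      exact ⟨⟨h₂.1, h₁.1⟩, ⟨h₂.2, h₁.2⟩⟩
    intro i
    induction i using Int.induction_on with
    | zero => simp
    | succ i ih => exact ⟨(hsucc _).1.trans ih.1, (hsucc _).2.trans ih.2⟩
    | pred i ih =>
      have := hsucc (-i - 1)
      rw [sub_add_cancel] at this
      exact ⟨this.1.symm.trans ih.1, this.2.symm.trans ih.2⟩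
  rintro _ ⟨i, rfl⟩ _ ⟨j, rfl⟩ v hv
  have hi := hstep v hv i
  have hj := hstep v hv j
  exact ⟨fun h => hj.1.2 (hi.1.1 h), fun h => hj.2.2 (hi.2.1 h)⟩

/-- If twins generate the group, then the connection set is empty or everything but `1`,
so every subgroup is a module. -/
theorem isModule_of_zpowers_eq_top [Finite G] {S : Set G} {a : G}
    (ha : IsModule (cay G S) {1, a}) (htop : Subgroup.zpowers a = ⊤) (K : Subgroup G) :
    IsModule (cay G S) (K : Set G) := by
  have hpow : ∀ n : ℕ, n + 1 < orderOf a → (a ^ (n + 1) ∈ S ↔ a ∈ S) := by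
    intro n
    induction n with
    | zero => simp
    | succ n ih =>
      intro hn
      rw [← ih (by lia)]
      have hv : a ^ (n + 1 + 1) ∉ ({1, a} : Set G) := by
        rintro (h | h)
        · exact pow_ne_one_of_lt_orderOf (by lia) hn h
        · have h' : a ^ (n + 1) = 1 := by
            rw [Set.mem_singleton_iff, pow_succ] at h
            simpa using h
          exact pow_ne_one_of_lt_orderOf (by lia) (by lia) h'
      have h₁ := (ha 1 (by simp) a (by simp) _ hv).2
      have h₂ := (ha a (by simp) 1 (by simp) _ hv).2
      have e : a⁻¹ * a ^ (n + 1 + 1) = a ^ (n + 1) := by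
        rw [pow_succ' a (n + 1)]
        simp
      simp only [cay_adj, e, inv_one, one_mul] at h₁ h₂
      exact ⟨h₁, h₂⟩
  have hmem : ∀ g : G, g ≠ 1 → (g ∈ S ↔ a ∈ S) := by
    intro g hg
    have hgz : g ∈ Subgroup.zpowers a := htop ▸ Subgroup.mem_top g
    classical
    obtain ⟨n, hn, rfl⟩ := Finset.mem_image.1 (mem_zpowers_iff_mem_range_orderOf.1 hgz)
    obtain ⟨m, rfl⟩ := Nat.exists_eq_succ_of_ne_zero (n := n) (by rintro rfl; simp at hg)
    exact hpow m (Finset.mem_range.1 hn)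
  intro x hx y hy v hv
  have hne : ∀ z ∈ K, z⁻¹ * v ≠ 1 ∧ v⁻¹ * z ≠ 1 := by
    intro z hz
    rw [ne_eq, ne_eq, inv_mul_eq_one, inv_mul_eq_one]
    exact ⟨fun h => hv (h ▸ hz), fun h => hv (h ▸ hz)⟩
  simp [cay_adj, hmem _ (hne x hx).1, hmem _ (hne x hx).2, hmem _ (hne y hy).1,
    hmem _ (hne y hy).2]

theorem exists_subgroup_of_twins [Finite G] {S : Set G} {a : G} (ha1 : a ≠ 1)
    (ha : IsModule (cay G S) {1, a}) {m n : ℕ} (hm : 2 ≤ m) (hn : 2 ≤ n)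
    (hmn : Nat.card G = m * n) :
    ∃ K : Subgroup G, ⊥ < K ∧ K ≠ ⊤ ∧ IsModule (cay G S) (K : Set G) := by
  by_cases htop : Subgroup.zpowers a = ⊤
  · have hord : orderOf a = m * n := by
      rw [← Nat.card_zpowers, htop, Subgroup.card_top, hmn]
    have hcard : Nat.card (Subgroup.zpowers (a ^ m)) = n := by
      rw [Nat.card_zpowers, orderOf_pow, hord, Nat.gcd_mul_right_left,
        Nat.mul_div_cancel_left _ (by lia)]
    refine ⟨Subgroup.zpowers (a ^ m), ?_, ?_, isModule_of_zpowers_eq_top ha htop _⟩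
    · rw [bot_lt_iff_ne_bot, ← Subgroup.one_lt_card_iff_ne_bot, hcard]
      lia
    · intro h
      rw [h, Subgroup.card_top, hmn] at hcard
      nlinarith
  · refine ⟨_, ?_, htop, isModule_zpowers ha⟩
    rwa [bot_lt_iff_ne_bot, ne_eq, Subgroup.zpowers_eq_bot]

theorem exists_subgroup_of_isModule [Finite G] {S : Set G} {N : Set G}
    (hN : IsModule (cay G S) N) (hN2 : N.Nontrivial) (hNtop : N ≠ Set.univ) {m n : ℕ}
    (hm : 2 ≤ m) (hn : 2 ≤ n) (hmn : Nat.card G = m * n) :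
    ∃ K : Subgroup G, ⊥ < K ∧ K ≠ ⊤ ∧ IsModule (cay G S) (K : Set G) := by
  obtain ⟨M₀, ⟨hM₀, hM₀2⟩, hmin₀⟩ := Set.exists_min_image
    {M : Set G | IsModule (cay G S) M ∧ M.Nontrivial} Set.ncard (Set.toFinite _) ⟨N, hN, hN2⟩
  obtain ⟨x, hx⟩ := hM₀2.nonempty
  obtain ⟨M, hM, h1, hcard⟩ : ∃ M : Set G, IsModule (cay G S) M ∧ (1 : G) ∈ M ∧
      M.ncard = M₀.ncard :=
    ⟨x⁻¹ • M₀, hM₀.smul _, by simpa using Set.smul_mem_smul_set (a := x⁻¹) hx,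
      Set.ncard_smul_set _ _⟩
  have hM2 : 1 < M.ncard := hcard ▸ (Set.one_lt_ncard_iff_nontrivial.2 hM₀2)
  have hmin : ∀ L : Set G, IsModule (cay G S) L → L.ncard < M.ncard → L.ncard ≤ 1 := by
    intro L hL hlt
    by_contra! hL1
    have := hmin₀ L ⟨hL, Set.one_lt_ncard_iff_nontrivial.1 hL1⟩
    lia
  by_cases hblock : ∀ g : G, (M ∩ g • M).Nonempty → g • M = M
  · obtain ⟨K, rfl⟩ := exists_subgroup_coe_eq h1 hblock
    refine ⟨K, ?_, ?_, hM⟩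
    · rw [bot_lt_iff_ne_bot, ← Subgroup.one_lt_card_iff_ne_bot]
      exact hM2
    · rintro rfl
      have hlt := Set.ncard_lt_ncard (Set.ssubset_univ_iff.2 hNtop)
      have hle := hmin₀ N ⟨hN, hN2⟩
      rw [Subgroup.coe_top] at hcard
      lia
  · push Not at hblock
    obtain ⟨g, hg, hne⟩ := hblock
    have hgcard : (g • M).ncard = M.ncard := Set.ncard_smul_set _ _
    have hdiff : ¬ g • M ⊆ M := fun h => hne (Set.eq_of_subset_of_ncard_le h hgcard.ge)
    have hdiff' : ¬ M ⊆ g • M := fun h => hne (Set.eq_of_subset_of_ncard_le h hgcard.le).symm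
    have hinter := hmin _ (hM.inter (hM.smul g)) <| Set.ncard_lt_ncard
      ⟨Set.inter_subset_left, fun h => hdiff' fun y hy => (h hy).2⟩
    have hsdiff := hmin _ (hM.diff (hM.smul g) (Set.sdiff_nonempty.2 hdiff)) <|
      Set.ncard_lt_ncard ⟨Set.sdiff_subset, fun h => by
        obtain ⟨y, hy⟩ := hg
        exact (h hy.1).2 hy.2⟩
    have hsum := Set.ncard_inter_add_ncard_sdiff_eq_ncard M (g • M)
    obtain ⟨u, v, huv, rfl⟩ := Set.ncard_eq_two.1 (show M.ncard = 2 by lia)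
    rcases h1 with rfl | h1
    · exact exists_subgroup_of_twins huv.symm hM hm hn hmn
    · obtain rfl : 1 = v := h1
      rw [Set.pair_comm] at hM
      exact exists_subgroup_of_twins huv hM hm hn hmn

theorem exists_subgroup_of_isNontrivialWreathProduct [Finite G] {S : Set G}
    (h : IsNontrivialWreathProduct (cay G S)) :
    ∃ K : Subgroup G, ⊥ < K ∧ K ≠ ⊤ ∧ IsModule (cay G S) (K : Set G) := by
  obtain ⟨V₁, V₂, Γ₁, Γ₂, -, -, hV₁, hV₂, ⟨e⟩⟩ := h
  have : Finite V₁ := Nat.finite_of_card_ne_zero (by lia)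
  have : Finite V₂ := Nat.finite_of_card_ne_zero (by lia)
  have : Nontrivial V₁ := Finite.one_lt_card_iff_nontrivial.1 hV₁
  have : Nontrivial V₂ := Finite.one_lt_card_iff_nontrivial.1 hV₂
  obtain ⟨x, y, hxy⟩ := exists_pair_ne V₁
  obtain ⟨u, v, huv⟩ := exists_pair_ne V₂
  refine exists_subgroup_of_isModule (N := {g | (e.toEquiv g).1 = x}) ?_ ?_ ?_ hV₁ hV₂
    ((Nat.card_congr e.toEquiv).trans (Nat.card_prod _ _))
  · intro a ha b hb w hw
    simp only [Set.mem_ofPred_eq] at ha hb hw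
    simp [← e.adj_iff, wr, ha, hb, hw, Ne.symm hw]
  · exact ⟨e.toEquiv.symm (x, u), by simp, e.toEquiv.symm (x, v), by simp, by simpa using huv⟩
  · intro htop
    have : e.toEquiv.symm (y, u) ∈ {g | (e.toEquiv g).1 = x} := htop ▸ Set.mem_univ _
    exact hxy (by simpa using this.symm)

end

/-- `Cay(G,S)` is isomorphic to a nontrivial wreath product of two
vertex-transitive digraphs of smaller order iff there is a subgroup `1 < K < G` with
`S∖K` a union of double cosets of `K`; and in that case
`Cay(G,S) ≅ Γ/ℬ ≀ Γ[K] ≅ Cos(G,K,S∖K) ≀ Cay(K,S∩K)`. -/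
theorem statement_6 {G : Type*} [Group G] [Finite G] (S : Set G) (h1 : (1 : G) ∉ S) :
    (IsNontrivialWreathProduct (cay G S) ↔
      ∃ K : Subgroup G, ⊥ < K ∧ K ≠ ⊤ ∧
        (K : Set G) * (S \ (K : Set G)) * (K : Set G) = S \ (K : Set G)) ∧
    ∀ K : Subgroup G, ⊥ < K → K ≠ ⊤ →
      (K : Set G) * (S \ (K : Set G)) * (K : Set G) = S \ (K : Set G) →
      Nonempty (Iso (cay G S)
          (wr (quotDgr (cay G S) {B | ∃ g : G, B = g • (K : Set G)})
            (induce (cay G S) (K : Set G)))) ∧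
      Nonempty (Iso (cay G S)
          (wr (cos G K (S \ (K : Set G))) (cay K {k : K | (k : G) ∈ S}))) := by
  refine ⟨⟨fun h => ?_, ?_⟩, fun K _ _ hK => ?_⟩
  · obtain ⟨K, hbot, htop, hK⟩ := exists_subgroup_of_isNontrivialWreathProduct h
    exact ⟨K, hbot, htop, hK.mul_mul_eq⟩
  · rintro ⟨K, hbot, htop, hK⟩
    exact isNontrivialWreathProduct_of_subgroup S K hbot htop hK
  · exact ⟨⟨(cayIsoWr S K hK).trans ((cosIsoQuot S K hK).wrCongr (cayIsoInduce S K))⟩,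
      ⟨cayIsoWr S K hK⟩⟩

end DCG
end

section
/- Let G be a finite group, H ≤ G, and S ⊆ G with S ∩ H = ∅. Then HSH = S (i.e., Cos(G,H,S) is a well-defined double coset digraph of G) if and only if the partition of G into left cosets of H refines the partition of G into equivalence classes of the relation R on the Cayley digraph Cay(G,S). Moreover, in that case Cos(G,H,S) equals the block quotient digraph Cay(G,S)/(G/H), where G/H is the partition of G into left cosets of H. -/
open scoped Pointwise

namespace DCG

theorem cay_adj_iff {G : Type*} [Group G] {S : Set G} {a b : G} :
    (cay G S).Adj a b ↔ a⁻¹ * b ∈ S := by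
  constructor
  · rintro ⟨s, hs, rfl⟩
    simpa using hs
  · exact fun h => ⟨a⁻¹ * b, h, by simp⟩

theorem subgroup_mul_mul_eq_iff {G : Type*} [Group G] {H : Subgroup G} {S : Set G} :
    (H : Set G) * S * (H : Set G) = S ↔
      ∀ h ∈ H, ∀ s ∈ S, h * s ∈ S ∧ s * h ∈ S := by
  constructor
  · intro hS h hh s hs
    constructor
    · rw [← hS]
      exact ⟨h * s, ⟨h, hh, s, hs, rfl⟩, 1, H.one_mem, mul_one _⟩
    · rw [← hS]
      exact ⟨s, ⟨1, H.one_mem, s, hs, one_mul _⟩, h, hh, rfl⟩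
  · intro hS
    apply Set.Subset.antisymm
    · rintro _ ⟨_, ⟨h, hh, s, hs, rfl⟩, k, hk, rfl⟩
      exact (hS k hk _ (hS h hh s hs).1).2
    · intro s hs
      exact ⟨s, ⟨1, H.one_mem, s, hs, one_mul _⟩, 1, H.one_mem, mul_one _⟩

theorem cos_eq_cosetQuot {G : Type*} [Group G] {H : Subgroup G} {S : Set G}
    (hdisj : S ∩ (H : Set G) = ∅) : cos G H S = cosetQuot G H (cay G S) := by
  ext a b
  constructor
  · rintro ⟨g, s, hs, rfl, rfl⟩
    refine ⟨fun hab => ?_, g, g * s, rfl, rfl, s, hs, rfl⟩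
    have hsH : s ∈ H := by simpa using QuotientGroup.eq.mp hab
    exact Set.notMem_empty s (hdisj ▸ ⟨hs, hsH⟩)
  · rintro ⟨-, g, _, rfl, rfl, s, hs, rfl⟩
    exact ⟨g, s, hs, rfl, rfl⟩

/-- For `S ∩ H = ∅`, one has `HSH = S` iff the partition of `G` into left
cosets of `H` refines the partition of `G` into classes of the relation `R` (equal out- and
in-neighbourhoods) of `Cay(G,S)`; and in that case `Cos(G,H,S)` equals the block quotient
`Cay(G,S)/(G/H)`. -/
theorem statement_12 {G : Type*} [Group G] [Finite G] (H : Subgroup G) (S : Set G)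
    (hdisj : S ∩ (H : Set G) = ∅) :
    ((H : Set G) * S * (H : Set G) = S ↔
      ∀ x y : G, x⁻¹ * y ∈ H →
        (∀ w : G, (cay G S).Adj x w ↔ (cay G S).Adj y w) ∧
        (∀ w : G, (cay G S).Adj w x ↔ (cay G S).Adj w y)) ∧
    ((H : Set G) * S * (H : Set G) = S → cos G H S = cosetQuot G H (cay G S)) := by
  refine ⟨?_, fun _ => cos_eq_cosetQuot hdisj⟩
  simp only [subgroup_mul_mul_eq_iff, cay_adj_iff]
  constructor
  · intro hS x y hxy
    have hyx : y⁻¹ * x ∈ H := by simpa using H.inv_mem hxy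
    refine ⟨fun w => ⟨fun hw => ?_, fun hw => ?_⟩, fun w => ⟨fun hw => ?_, fun hw => ?_⟩⟩
    · simpa [mul_assoc] using (hS _ hyx _ hw).1
    · simpa [mul_assoc] using (hS _ hxy _ hw).1
    · simpa [mul_assoc] using (hS _ hxy _ hw).2
    · simpa [mul_assoc] using (hS _ hyx _ hw).2
  · intro hR h hh s hs
    constructor
    · simpa using ((hR h⁻¹ 1 (by simpa using hh)).1 s).mpr (by simpa using hs)
    · simpa [mul_assoc] using ((hR s (s * h) (by simpa using hh)).2 1).mp (by simpa using hs)

end DCG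
end

section
/- Let G be a finite group and, for i = 1,2, let H_i ≤ K_i ≤ G with |H₁| = |H₂| and |K₁| = |K₂|, and let S_i ⊆ G satisfy K_i ∩ S_i = ∅ and K_iS_iK_i = S_i. Suppose δ : G/K₁ → G/K₂ is an isomorphism from Cos(G,K₁,S₁) to Cos(G,K₂,S₂). Let δ̃ : G/H₁ → G/H₂ be any map such that for every g ∈ G, δ̃ maps the set of left cosets of H₁ contained in gK₁ bijectively onto the set of left cosets of H₂ contained in δ(gK₁). Then δ̃ is an isomorphism from Cos(G,H₁,S₁) to Cos(G,H₂,S₂). -/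
open scoped Pointwise

namespace DCG

lemma mem_of_mem_of_mem {G : Type*} [Group G] {K : Subgroup G} {S : Set G}
    (hS : (K : Set G) * S * (K : Set G) = S) {k s l : G} (hk : k ∈ K) (hs : s ∈ S)
    (hl : l ∈ K) : k * s * l ∈ S := by
  rw [← hS]
  exact Set.mul_mem_mul (Set.mul_mem_mul hk hs) hl

lemma cos_adj_mk_iff {G : Type*} [Group G] {H K : Subgroup G} (hHK : H ≤ K) {S : Set G}
    (hS : (K : Set G) * S * (K : Set G) = S) (a b : G) :
    (cos G H S).Adj (QuotientGroup.mk a) (QuotientGroup.mk b) ↔ a⁻¹ * b ∈ S := by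
  constructor
  · rintro ⟨g, s, hs, ha, hb⟩
    have key := mem_of_mem_of_mem hS (hHK (QuotientGroup.eq.mp ha)) hs
      (hHK (QuotientGroup.eq.mp hb.symm))
    convert key using 1
    group
  · intro h
    exact ⟨a, a⁻¹ * b, h, rfl, by rw [mul_inv_cancel_left]⟩

lemma mk_mem_image_smul_iff {G : Type*} [Group G] {H K : Subgroup G} (hHK : H ≤ K) (a g : G) :
    (QuotientGroup.mk a : G ⧸ H) ∈ (QuotientGroup.mk : G → G ⧸ H) '' (g • (K : Set G)) ↔
      (QuotientGroup.mk g : G ⧸ K) = QuotientGroup.mk a := by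
  constructor
  · rintro ⟨_, ⟨k, hk, rfl⟩, hka⟩
    rw [QuotientGroup.eq]
    convert K.mul_mem hk (hHK (QuotientGroup.eq.mp hka)) using 1
    simp only [smul_eq_mul]
    group
  · intro h
    exact ⟨a, ⟨g⁻¹ * a, QuotientGroup.eq.mp h, by simp⟩, rfl⟩

/-- Given an isomorphism `δ : Cos(G,K₁,S₁) → Cos(G,K₂,S₂)` with
`H_i ≤ K_i`, `|H₁| = |H₂|`, `|K₁| = |K₂|`, any map `δ̃ : G/H₁ → G/H₂` mapping, for each
`g ∈ G`, the left cosets of `H₁` contained in `gK₁` bijectively onto the left cosets of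
`H₂` contained in `δ(gK₁)`, is an isomorphism from `Cos(G,H₁,S₁)` to `Cos(G,H₂,S₂)`. -/
theorem statement_16 {G : Type*} [Group G] [Finite G] (H₁ H₂ K₁ K₂ : Subgroup G)
    (hH₁ : H₁ ≤ K₁) (hH₂ : H₂ ≤ K₂)
    (hcardH : Nat.card H₁ = Nat.card H₂) (hcardK : Nat.card K₁ = Nat.card K₂)
    (S₁ S₂ : Set G)
    (h₁d : (K₁ : Set G) ∩ S₁ = ∅) (h₁ : (K₁ : Set G) * S₁ * (K₁ : Set G) = S₁)
    (h₂d : (K₂ : Set G) ∩ S₂ = ∅) (h₂ : (K₂ : Set G) * S₂ * (K₂ : Set G) = S₂)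
    (δ : Iso (cos G K₁ S₁) (cos G K₂ S₂))
    (f : G ⧸ H₁ → G ⧸ H₂)
    (hf : ∀ g : G, Set.BijOn f
      ((QuotientGroup.mk : G → G ⧸ H₁) '' (g • (K₁ : Set G)))
      {x : G ⧸ H₂ | ∃ a : G, (QuotientGroup.mk a : G ⧸ H₂) = x ∧
        (QuotientGroup.mk a : G ⧸ K₂) = δ.toEquiv (QuotientGroup.mk g)}) :
    Function.Bijective f ∧
      ∀ u v : G ⧸ H₁, (cos G H₂ S₂).Adj (f u) (f v) ↔ (cos G H₁ S₁).Adj u v := by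
  have hmap (a : G) : ∃ a' : G, (QuotientGroup.mk a' : G ⧸ H₂) = f (QuotientGroup.mk a) ∧
      (QuotientGroup.mk a' : G ⧸ K₂) = δ.toEquiv (QuotientGroup.mk a) :=
    (hf a).mapsTo ((mk_mem_image_smul_iff hH₁ a a).mpr rfl)
  refine ⟨⟨fun u v huv => ?_, fun x => ?_⟩, fun u v => ?_⟩
  · obtain ⟨a, rfl⟩ := QuotientGroup.mk_surjective u
    obtain ⟨b, rfl⟩ := QuotientGroup.mk_surjective v
    obtain ⟨a', ha, ha'⟩ := hmap a
    obtain ⟨b', hb, hb'⟩ := hmap b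
    have hab : (QuotientGroup.mk a' : G ⧸ K₂) = QuotientGroup.mk b' :=
      QuotientGroup.eq.mpr (hH₂ (QuotientGroup.eq.mp (ha.trans (huv.trans hb.symm))))
    exact (hf a).injOn ((mk_mem_image_smul_iff hH₁ a a).mpr rfl)
      ((mk_mem_image_smul_iff hH₁ b a).mpr
        (δ.toEquiv.injective (ha'.symm.trans (hab.trans hb')))) huv
  · obtain ⟨a, rfl⟩ := QuotientGroup.mk_surjective x
    obtain ⟨g, hg⟩ := QuotientGroup.mk_surjective (δ.toEquiv.symm (QuotientGroup.mk a))
    obtain ⟨u, -, hu⟩ := (hf g).surjOn ⟨a, rfl, by rw [hg, Equiv.apply_symm_apply]⟩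
    exact ⟨u, hu⟩
  · obtain ⟨a, rfl⟩ := QuotientGroup.mk_surjective u
    obtain ⟨b, rfl⟩ := QuotientGroup.mk_surjective v
    obtain ⟨a', ha, ha'⟩ := hmap a
    obtain ⟨b', hb, hb'⟩ := hmap b
    rw [← ha, ← hb, cos_adj_mk_iff hH₂ h₂, cos_adj_mk_iff hH₁ h₁,
      ← cos_adj_mk_iff le_rfl h₂, ← cos_adj_mk_iff le_rfl h₁, ha', hb']
    exact δ.adj_iff _ _

end DCG
end
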